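/- Consider the problem ${\rm APP} = \{{\rm APP}_{\infty,d}\}_{d \in \mathbb{N}}$ in the worst case setting for the absolute or normalized error criterion $\star \in \{{\rm ABS}, {\rm NOR}\}$. Then for any fixed $s, t > 0$, ${\rm APP}$ is exponentially $(s,t)$-weakly tractable (EXP-$(s,t)$-WT) for $\Lambda^{\rm all}$ if and only if it is EXP-$(s,t)$-WT for $\Lambda^{\rm std}$. In particular (taking $s = t = 1$), ${\rm APP}$ is exponentially weakly tractable for $\Lambda^{\rm all}$ if and only if it is exponentially weakly tractable for $\Lambda^{\rm std}$. -/

import Mathlib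

open Filter
open scoped ENNReal NNReal

noncomputable section

/-- Coefficient space: `ℓ²` sequences indexed by `ℤ^d`.  An element `u` represents the
function `f ∈ H^ω(𝕋^d)` with Fourier coefficients `f̂(k) = u k / ω k`, so that
`‖u‖_{ℓ²} = ‖f‖_{H^ω}`. -/
abbrev Coef (d : ℕ) := lp (fun _ : Fin d → ℤ => ℂ) 2

/-- The periodic function represented by the coefficients `u`:
`f(x) = ∑_{k ∈ ℤ^d} (u k / ω k) e^{2πi k·x}`. -/
def torusFn {d : ℕ} (ω : (Fin d → ℤ) → ℝ) (u : Coef d) (x : Fin d → ℝ) : ℂ :=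
  ∑' k : Fin d → ℤ,
    ((ω k : ℂ))⁻¹ * u k * Complex.exp (2 * Real.pi * Complex.I * ∑ j, (k j : ℂ) * (x j : ℂ))

/-- The torus `𝕋^d`, modelled as the cube `[0,1]^d`. -/
def cube (d : ℕ) : Set (Fin d → ℝ) := {x | ∀ j, x j ∈ Set.Icc (0 : ℝ) 1}

/-- Standard information: point-evaluation functionals `f ↦ f(x)`. -/
def stdInfo {d : ℕ} (ω : (Fin d → ℤ) → ℝ) : Set (Coef d → ℂ) :=
  {L | ∃ x ∈ cube d, L = fun u => torusFn ω u x}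

/-- General linear information: all continuous linear functionals on `H^ω`. -/
def allInfo (d : ℕ) : Set (Coef d → ℂ) := {L | ∃ T : Coef d →L[ℂ] ℂ, L = ⇑T}

/-- The `n`-th minimal worst case error `e(n, APP_{∞,d}; Λ)` of `L_∞`-approximation on the
unit ball of `H^ω(𝕋^d)`, using algorithms `f ↦ φ(L₁ f, …, Lₙ f)` with `Lᵢ ∈ Λ`. -/
def wcErr {d : ℕ} (ω : (Fin d → ℤ) → ℝ) (Λ : Set (Coef d → ℂ)) (n : ℕ) : ℝ≥0∞ :=
  ⨅ (L : Fin n → Coef d → ℂ) (_ : ∀ i, L i ∈ Λ) (φ : (Fin n → ℂ) → (Fin d → ℝ) → ℂ),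
    ⨆ (u : Coef d) (_ : ‖u‖ ≤ 1) (x : Fin d → ℝ) (_ : x ∈ cube d),
      (‖torusFn ω u x - φ (fun i => L i u) x‖₊ : ℝ≥0∞)

/-- The initial error `e(0, APP_{∞,d}) = sup_{‖f‖_{H^ω} ≤ 1} ‖f‖_∞`. -/
def initErr {d : ℕ} (ω : (Fin d → ℤ) → ℝ) : ℝ≥0∞ :=
  ⨆ (u : Coef d) (_ : ‖u‖ ≤ 1) (x : Fin d → ℝ) (_ : x ∈ cube d),
    (‖torusFn ω u x‖₊ : ℝ≥0∞)

/-- The error criterion: absolute (ABS) or normalized (NOR). -/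
inductive Crit | ABS | NOR

/-- `CRI_d`: the normalizing quantity of the error criterion. -/
def CRI {d : ℕ} (ω : (Fin d → ℤ) → ℝ) : Crit → ℝ≥0∞
  | Crit.ABS => 1
  | Crit.NOR => initErr ω

/-- The information complexity `n^⋆(ε, d; Λ)`. -/
def infoComp {d : ℕ} (ω : (Fin d → ℤ) → ℝ) (Λ : Set (Coef d → ℂ)) (crit : Crit) (ε : ℝ) : ℕ :=
  sInf {n : ℕ | wcErr ω Λ n ≤ ENNReal.ofReal ε * CRI ω crit}

/-- Algebraic strong polynomial tractability of the family of information complexities `nc`. -/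
def ALGSPT (nc : ℕ → ℝ → ℕ) : Prop :=
  ∃ C > (0:ℝ), ∃ p ≥ (0:ℝ), ∀ d : ℕ, 0 < d → ∀ ε ∈ Set.Ioo (0:ℝ) 1,
    (nc d ε : ℝ) ≤ C * ε ^ (-p)

/-- The exponent of algebraic strong polynomial tractability. -/
def ALGSPTexp (nc : ℕ → ℝ → ℕ) : ℝ :=
  sInf {p : ℝ | 0 ≤ p ∧ ∃ C > (0:ℝ), ∀ d : ℕ, 0 < d → ∀ ε ∈ Set.Ioo (0:ℝ) 1,
    (nc d ε : ℝ) ≤ C * ε ^ (-p)}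

/-- Algebraic polynomial tractability. -/
def ALGPT (nc : ℕ → ℝ → ℕ) : Prop :=
  ∃ C > (0:ℝ), ∃ p ≥ (0:ℝ), ∃ q ≥ (0:ℝ), ∀ d : ℕ, 0 < d → ∀ ε ∈ Set.Ioo (0:ℝ) 1,
    (nc d ε : ℝ) ≤ C * (d : ℝ) ^ q * ε ^ (-p)

/-- Algebraic quasi-polynomial tractability. -/
def ALGQPT (nc : ℕ → ℝ → ℕ) : Prop :=
  ∃ C > (0:ℝ), ∃ t ≥ (0:ℝ), ∀ d : ℕ, 0 < d → ∀ ε ∈ Set.Ioo (0:ℝ) 1,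
    (nc d ε : ℝ) ≤ C * Real.exp (t * (1 + Real.log d) * (1 + Real.log ε⁻¹))

/-- The exponent of algebraic quasi-polynomial tractability. -/
def ALGQPTexp (nc : ℕ → ℝ → ℕ) : ℝ :=
  sInf {t : ℝ | 0 ≤ t ∧ ∃ C > (0:ℝ), ∀ d : ℕ, 0 < d → ∀ ε ∈ Set.Ioo (0:ℝ) 1,
    (nc d ε : ℝ) ≤ C * Real.exp (t * (1 + Real.log d) * (1 + Real.log ε⁻¹))}

/-- Exponential quasi-polynomial tractability. -/
def EXPQPT (nc : ℕ → ℝ → ℕ) : Prop :=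
  ∃ C > (0:ℝ), ∃ t ≥ (0:ℝ), ∀ d : ℕ, 0 < d → ∀ ε ∈ Set.Ioo (0:ℝ) 1,
    (nc d ε : ℝ) ≤ C * Real.exp (t * (1 + Real.log d) * (1 + Real.log (Real.log ε⁻¹ + 1)))

/-- The exponent of exponential quasi-polynomial tractability. -/
def EXPQPTexp (nc : ℕ → ℝ → ℕ) : ℝ :=
  sInf {t : ℝ | 0 ≤ t ∧ ∃ C > (0:ℝ), ∀ d : ℕ, 0 < d → ∀ ε ∈ Set.Ioo (0:ℝ) 1,
    (nc d ε : ℝ) ≤ C * Real.exp (t * (1 + Real.log d) * (1 + Real.log (Real.log ε⁻¹ + 1)))}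

/-- `lim_{ε⁻¹ + d → ∞} (log nc(d, ε)) / den(d, ε) = 0`. -/
def WTlim (den : ℕ → ℝ → ℝ) (nc : ℕ → ℝ → ℕ) : Prop :=
  ∀ δ > (0:ℝ), ∃ M : ℝ, ∀ d : ℕ, 0 < d → ∀ ε ∈ Set.Ioo (0:ℝ) 1,
    M ≤ ε⁻¹ + d → |Real.log (nc d ε) / den d ε| < δ

/-- Algebraic `(s,t)`-weak tractability; `ALGWTst 1 1` is algebraic weak tractability. -/
def ALGWTst (s t : ℝ) (nc : ℕ → ℝ → ℕ) : Prop :=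
  WTlim (fun d ε => ε ^ (-s) + (d : ℝ) ^ t) nc

/-- Algebraic uniform weak tractability. -/
def ALGUWT (nc : ℕ → ℝ → ℕ) : Prop := ∀ α > (0:ℝ), ∀ β > (0:ℝ), ALGWTst α β nc

/-- Exponential `(s,t)`-weak tractability; `EXPWTst 1 1` is exponential weak tractability. -/
def EXPWTst (s t : ℝ) (nc : ℕ → ℝ → ℕ) : Prop :=
  WTlim (fun d ε => (1 + Real.log ε⁻¹) ^ s + (d : ℝ) ^ t) nc

/-- Exponential uniform weak tractability. -/
def EXPUWT (nc : ℕ → ℝ → ℕ) : Prop := ∀ α > (0:ℝ), ∀ β > (0:ℝ), EXPWTst α β nc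


/-! ### Characters -/

def chi {d : ℕ} (k : Fin d → ℤ) (x : Fin d → ℝ) : ℂ :=
  Complex.exp (2 * Real.pi * Complex.I * ∑ j, (k j : ℂ) * (x j : ℂ))

lemma chi_zero {d : ℕ} (x : Fin d → ℝ) : chi 0 x = 1 := by simp [chi]

lemma norm_chi {d : ℕ} (k : Fin d → ℤ) (x : Fin d → ℝ) : ‖chi k x‖ = 1 := by
  have : (2 * Real.pi * Complex.I * ∑ j, (k j : ℂ) * (x j : ℂ)) =
      ((2 * Real.pi * ∑ j, (k j : ℝ) * x j : ℝ) : ℂ) * Complex.I := by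
    push_cast; ring
  rw [chi, this, Complex.norm_exp_ofReal_mul_I]

lemma conj_chi {d : ℕ} (k : Fin d → ℤ) (x : Fin d → ℝ) :
    (starRingEnd ℂ) (chi k x) = chi (-k) x := by
  rw [chi, chi, ← Complex.exp_conj]
  congr 1
  simp [map_sum]
  left
  exact map_ofNat _ 2

lemma chi_add {d : ℕ} (k l : Fin d → ℤ) (x : Fin d → ℝ) :
    chi (k + l) x = chi k x * chi l x := by
  rw [chi, chi, chi, ← Complex.exp_add]
  congr 1
  rw [← mul_add, ← Finset.sum_add_distrib]
  congr 1
  refine Finset.sum_congr rfl fun j _ => ?_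
  simp [add_mul]

lemma chi_mul_conj {d : ℕ} (k l : Fin d → ℤ) (x : Fin d → ℝ) :
    chi k x * (starRingEnd ℂ) (chi l x) = chi (k - l) x := by
  rw [conj_chi, ← chi_add, sub_eq_add_neg]

lemma integral_fourier_haar (n : ℤ) :
    ∫ x, (fourier n x : ℂ) ∂(AddCircle.haarAddCircle (T := (1:ℝ))) = if n = 0 then 1 else 0 := by
  have h := congrFun (fourierCoeff_fourier (T := (1:ℝ)) n) 0
  simp only [fourierCoeff, neg_zero, fourier_zero, one_smul] at h
  rw [h, Pi.single_apply]
  simp [eq_comm]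

/-- averaging -/
lemma exists_avg {d : ℕ} {α : Type} [Countable α] (c : α → ℂ) (hc : Summable fun a => ‖c a‖)
    (j : α → Fin d → ℤ) :
    ∃ x ∈ cube d, (∑' a, c a * chi (j a) x).re ≤ (∑' a, if j a = 0 then c a else 0).re := by
  classical
  let μ : MeasureTheory.Measure (Fin d → AddCircle (1:ℝ)) :=
    MeasureTheory.Measure.pi (fun _ => AddCircle.haarAddCircle)
  let F : α → (Fin d → AddCircle (1:ℝ)) → ℂ := fun a y => c a * ∏ i, fourier (j a i) (y i)
  have hn : ∀ a y, ‖F a y‖ = ‖c a‖ := by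
    intro a y
    simp only [F, norm_mul, norm_prod, fourier_apply, Circle.norm_coe, Finset.prod_const_one, mul_one]
  have hcont : ∀ a, Continuous (F a) := by
    intro a; fun_prop
  have hint : ∀ a, MeasureTheory.Integrable (F a) μ := by
    intro a
    refine MeasureTheory.Integrable.of_bound (hcont a).aestronglyMeasurable ‖c a‖ ?_
    exact Filter.Eventually.of_forall fun y => (hn a y).le
  have hI : ∀ a, ∫ y, F a y ∂μ = if j a = 0 then c a else 0 := by
    intro a
    simp only [F]
    rw [MeasureTheory.integral_const_mul]
    have := MeasureTheory.integral_fintype_prod_eq_prod (𝕜 := ℂ)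
      (μ := fun _ : Fin d => (AddCircle.haarAddCircle (T := (1:ℝ))))
      (fun i (y : AddCircle (1:ℝ)) => (fourier (j a i) y : ℂ))
    simp only [μ]
    rw [this]
    simp only [integral_fourier_haar]
    split_ifs with h
    · simp [h]
    · obtain ⟨i, hi⟩ := Function.ne_iff.mp h
      rw [Finset.prod_eq_zero (Finset.mem_univ i), mul_zero]
      simpa using hi
  have hs : HasSum (fun a => ∫ y, F a y ∂μ) (∫ y, ∑' a, F a y ∂μ) := by
    apply MeasureTheory.hasSum_integral_of_summable_integral_norm hint
    simpa [hn] using hc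
  have htc : Continuous fun y => ∑' a, F a y :=
    continuous_tsum hcont hc fun a y => (hn a y).le
  have hti : MeasureTheory.Integrable (fun y => ∑' a, F a y) μ := by
    refine MeasureTheory.Integrable.of_bound htc.aestronglyMeasurable (∑' a, ‖c a‖) ?_
    refine Filter.Eventually.of_forall fun y => ?_
    refine (norm_tsum_le_tsum_norm ?_).trans ?_
    · simpa [hn] using hc
    · simp [hn]
  have hre : ∫ y, (∑' a, F a y).re ∂μ = (∑' a, if j a = 0 then c a else 0).re := by
    have := integral_re hti
    simp only [RCLike.re_to_complex] at this
    rw [this, ← hs.tsum_eq]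
    simp only [hI]
  obtain ⟨y, hy⟩ := MeasureTheory.exists_le_integral (μ := μ) (f := fun y => (∑' a, F a y).re) hti.re
  rw [hre] at hy
  have hx : ∀ i, ∃ z : ℝ, z ∈ Set.Icc (0:ℝ) 1 ∧ (z : AddCircle (1:ℝ)) = y i := by
    intro i
    obtain ⟨z, hz⟩ := (AddCircle.equivIco (1:ℝ) 0).symm.surjective (y i)
    refine ⟨z, ⟨z.2.1, by simpa using z.2.2.le⟩, ?_⟩
    rw [← hz]; rfl
  choose x hx1 hx2 using hx
  refine ⟨x, hx1, ?_⟩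
  convert hy using 4 with a
  simp only [F, chi]
  congr 1
  rw [Finset.mul_sum, Complex.exp_sum]
  refine Finset.prod_congr rfl fun i _ => ?_
  rw [← hx2 i, fourier_coe_apply]
  congr 1
  push_cast; ring

/-! ### Exponential sums -/

lemma cs_tsum {α : Type} (f g : α → ℝ) (hf : ∀ a, 0 ≤ f a) (hg : ∀ a, 0 ≤ g a)
    (hf2 : Summable fun a => f a ^ 2) (hg2 : Summable fun a => g a ^ 2) :
    Summable (fun a => f a * g a) ∧
      ∑' a, f a * g a ≤ Real.sqrt (∑' a, f a ^ 2) * Real.sqrt (∑' a, g a ^ 2) := by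
  have h := Real.summable_and_inner_le_Lp_mul_Lq_tsum_of_nonneg (p := 2) (q := 2)
    Real.HolderConjugate.two_two hf hg (by simpa using hf2) (by simpa using hg2)
  refine ⟨h.1, ?_⟩
  have h2 := h.2
  simp only [Real.rpow_two] at h2
  rwa [← Real.sqrt_eq_rpow, ← Real.sqrt_eq_rpow] at h2

def Ssum {d m : ℕ} (x : Fin m → Fin d → ℝ) (j : Fin d → ℤ) : ℂ :=
  if j = 0 then 0 else ∑ i, chi j (x i)

lemma norm_Ssum_le {d m : ℕ} (x : Fin m → Fin d → ℝ) (j : Fin d → ℤ) : ‖Ssum x j‖ ≤ m := by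
  unfold Ssum
  split_ifs
  · simp
  · refine (norm_sum_le _ _).trans ?_
    simp [norm_chi]

lemma sum_chi_eq {d m : ℕ} (x : Fin m → Fin d → ℝ) (j : Fin d → ℤ) :
    ∑ i, chi j (x i) = (if j = 0 then (m : ℂ) else 0) + Ssum x j := by
  unfold Ssum
  split_ifs with h
  · simp [h, chi_zero]
  · simp

lemma normsq_expand {d : ℕ} (c : (Fin d → ℤ) → ℂ) (hc : Summable fun k => ‖c k‖)
    (x : Fin d → ℝ) :
    ((‖∑' k, c k * chi k x‖ ^ 2 : ℝ) : ℂ) =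
      ∑' p : (Fin d → ℤ) × (Fin d → ℤ),
        c p.1 * (starRingEnd ℂ) (c p.2) * chi (p.1 - p.2) x := by
  have h := Complex.mul_conj (∑' k, c k * chi k x)
  rw [Complex.normSq_eq_norm_sq] at h
  rw [← h, Complex.conj_tsum, tsum_mul_tsum_of_summable_norm]
  · refine tsum_congr fun p => ?_
    rw [← chi_mul_conj, map_mul]; ring
  · simpa [norm_chi] using hc
  · simpa [norm_chi] using hc

lemma summable_pair {d : ℕ} (c : (Fin d → ℤ) → ℂ) (hc : Summable fun k => ‖c k‖) :
    Summable fun p : (Fin d → ℤ) × (Fin d → ℤ) => ‖c p.1 * (starRingEnd ℂ) (c p.2)‖ := by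
  have := Summable.mul_of_nonneg hc hc (fun _ => norm_nonneg _) (fun _ => norm_nonneg _)
  simpa using this

lemma diag_sum {d : ℕ} (c : (Fin d → ℤ) → ℂ) (hc : Summable fun k => ‖c k‖) :
    (∑' p : (Fin d → ℤ) × (Fin d → ℤ),
        if p.1 - p.2 = 0 then c p.1 * (starRingEnd ℂ) (c p.2) else 0) =
      ((∑' k, ‖c k‖ ^ 2 : ℝ) : ℂ) := by
  have hs : Summable fun p : (Fin d → ℤ) × (Fin d → ℤ) =>
      if p.1 - p.2 = 0 then c p.1 * (starRingEnd ℂ) (c p.2) else 0 := by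
    refine Summable.of_norm_bounded (summable_pair c hc) fun p => ?_
    split_ifs <;> simp
    positivity
  rw [hs.tsum_prod, Complex.ofReal_tsum]
  refine tsum_congr fun k => ?_
  rw [tsum_eq_single k]
  · simp only [sub_self, if_true]
    rw [Complex.mul_conj, Complex.normSq_eq_norm_sq]
  · intro l hl
    rw [if_neg]
    rw [sub_eq_zero]
    exact fun h => hl h.symm

lemma expand_sum {d m : ℕ} (c : (Fin d → ℤ) → ℂ) (hc : Summable fun k => ‖c k‖)
    (x : Fin m → Fin d → ℝ) :
    ∑ i, ‖∑' k, c k * chi k (x i)‖ ^ 2 = m * ∑' k, ‖c k‖ ^ 2 +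
      (∑' p : (Fin d → ℤ) × (Fin d → ℤ),
        c p.1 * (starRingEnd ℂ) (c p.2) * Ssum x (p.1 - p.2)).re := by
  have hp := summable_pair c hc
  have hS : Summable fun p : (Fin d → ℤ) × (Fin d → ℤ) =>
        c p.1 * (starRingEnd ℂ) (c p.2) * Ssum x (p.1 - p.2) := by
    refine Summable.of_norm_bounded (hp.mul_right (m:ℝ)) fun p => ?_
    rw [norm_mul]
    gcongr
    exact norm_Ssum_le _ _
  have hs : Summable fun p : (Fin d → ℤ) × (Fin d → ℤ) =>
      if p.1 - p.2 = 0 then c p.1 * (starRingEnd ℂ) (c p.2) else 0 := by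
    refine Summable.of_norm_bounded hp fun p => ?_
    split_ifs <;> simp
    positivity
  have key : ((∑ i, ‖∑' k, c k * chi k (x i)‖ ^ 2 : ℝ) : ℂ) =
      ((m * ∑' k, ‖c k‖ ^ 2 : ℝ) : ℂ) + ∑' p : (Fin d → ℤ) × (Fin d → ℤ),
        c p.1 * (starRingEnd ℂ) (c p.2) * Ssum x (p.1 - p.2) := by
    rw [Complex.ofReal_sum]
    simp only [normsq_expand c hc]
    rw [← Summable.tsum_finsetSum]
    · rw [Complex.ofReal_mul, ← diag_sum c hc, ← tsum_mul_left, ← Summable.tsum_add]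
      · refine tsum_congr fun p => ?_
        rw [← Finset.mul_sum, sum_chi_eq]
        split_ifs <;> push_cast <;> ring
      · exact hs.mul_left _
      · exact hS
    · intro i _
      refine Summable.of_norm_bounded hp fun p => ?_
      rw [norm_mul, norm_chi, mul_one]
  have := congrArg Complex.re key
  rwa [Complex.add_re, Complex.ofReal_re, Complex.ofReal_re] at this

set_option maxHeartbeats 1000000 in
lemma expand_bound {d m : ℕ} (c : (Fin d → ℤ) → ℂ) (v b : (Fin d → ℤ) → ℝ)
    (hv : ∀ k, 0 ≤ v k) (hb : ∀ k, 0 ≤ b k) (hcv : ∀ k, ‖c k‖ = v k * b k)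
    (hv2 : Summable fun k => v k ^ 2) (hb2 : Summable fun k => b k ^ 2)
    (x : Fin m → Fin d → ℝ) :
    |∑ i, ‖∑' k, c k * chi k (x i)‖ ^ 2 - m * ∑' k, ‖c k‖ ^ 2| ≤
      (∑' k, b k ^ 2) * Real.sqrt (∑' p : (Fin d → ℤ) × (Fin d → ℤ),
        v p.1 ^ 2 * v p.2 ^ 2 * ‖Ssum x (p.1 - p.2)‖ ^ 2) := by
  have hc : Summable fun k => ‖c k‖ := by
    simp only [hcv]
    exact (cs_tsum v b hv hb hv2 hb2).1
  have hbb : Summable fun p : (Fin d → ℤ) × (Fin d → ℤ) => b p.1 ^ 2 * b p.2 ^ 2 :=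
    Summable.mul_of_nonneg hb2 hb2 (fun _ => sq_nonneg _) (fun _ => sq_nonneg _)
  have hvv : Summable fun p : (Fin d → ℤ) × (Fin d → ℤ) => v p.1 ^ 2 * v p.2 ^ 2 :=
    Summable.mul_of_nonneg hv2 hv2 (fun _ => sq_nonneg _) (fun _ => sq_nonneg _)
  have hvs : Summable fun p : (Fin d → ℤ) × (Fin d → ℤ) =>
      v p.1 ^ 2 * v p.2 ^ 2 * ‖Ssum x (p.1 - p.2)‖ ^ 2 := by
    refine Summable.of_nonneg_of_le (fun p => by positivity) (fun p => ?_) (hvv.mul_right ((m:ℝ)^2))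
    gcongr
    exact norm_Ssum_le _ _
  have hcs := cs_tsum (fun p : (Fin d → ℤ) × (Fin d → ℤ) => b p.1 * b p.2)
    (fun p => v p.1 * v p.2 * ‖Ssum x (p.1 - p.2)‖)
    (fun p => mul_nonneg (hb _) (hb _))
    (fun p => mul_nonneg (mul_nonneg (hv _) (hv _)) (norm_nonneg _))
    (by simpa only [mul_pow] using hbb) (by simpa only [mul_pow] using hvs)
  have hB : ∑' p : (Fin d → ℤ) × (Fin d → ℤ), b p.1 ^ 2 * b p.2 ^ 2 = (∑' k, b k ^ 2) ^ 2 := by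
    rw [sq, hb2.tsum_mul_tsum hb2 hbb]
  have hB0 : 0 ≤ ∑' k, b k ^ 2 := tsum_nonneg fun _ => sq_nonneg _
  simp only [mul_pow] at hcs
  rw [hB, Real.sqrt_sq hB0] at hcs
  rw [expand_sum c hc x, add_sub_cancel_left]
  refine (Complex.abs_re_le_norm _).trans ?_
  have e : ∀ p : (Fin d → ℤ) × (Fin d → ℤ),
      ‖c p.1 * (starRingEnd ℂ) (c p.2) * Ssum x (p.1 - p.2)‖ =
      b p.1 * b p.2 * (v p.1 * v p.2 * ‖Ssum x (p.1 - p.2)‖) := by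
    intro p
    rw [norm_mul, norm_mul, RCLike.norm_conj, hcv, hcv]; ring
  refine (norm_tsum_le_tsum_norm ?_).trans ?_
  · simp only [e]; exact hcs.1
  · simp only [e]; exact hcs.2

set_option maxHeartbeats 1000000 in
lemma greedy {d : ℕ} (v : (Fin d → ℤ) → ℝ) (hv2 : Summable fun k => v k ^ 2) (m : ℕ) :
    ∃ x : Fin m → Fin d → ℝ, (∀ i, x i ∈ cube d) ∧
      ∑' p : (Fin d → ℤ) × (Fin d → ℤ),
        v p.1 ^ 2 * v p.2 ^ 2 * ‖Ssum x (p.1 - p.2)‖ ^ 2 ≤ m * (∑' k, v k ^ 2) ^ 2 := by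
  have hvv : Summable fun p : (Fin d → ℤ) × (Fin d → ℤ) => v p.1 ^ 2 * v p.2 ^ 2 :=
    Summable.mul_of_nonneg hv2 hv2 (fun _ => sq_nonneg _) (fun _ => sq_nonneg _)
  have hV : ∑' p : (Fin d → ℤ) × (Fin d → ℤ), v p.1 ^ 2 * v p.2 ^ 2 = (∑' k, v k ^ 2) ^ 2 := by
    rw [sq, hv2.tsum_mul_tsum hv2 hvv]
  have hvs : ∀ {m : ℕ} (x : Fin m → Fin d → ℝ), Summable fun p : (Fin d → ℤ) × (Fin d → ℤ) =>
      v p.1 ^ 2 * v p.2 ^ 2 * ‖Ssum x (p.1 - p.2)‖ ^ 2 := by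
    intro m x
    refine Summable.of_nonneg_of_le (fun p => by positivity) (fun p => ?_) (hvv.mul_right ((m:ℝ)^2))
    gcongr
    exact norm_Ssum_le _ _
  induction m with
  | zero => 
    refine ⟨fun i => i.elim0, fun i => i.elim0, ?_⟩
    simp [Ssum]
  | succ m ih =>
    obtain ⟨x, hx, hS⟩ := ih
    let c : (Fin d → ℤ) × (Fin d → ℤ) → ℂ := fun p =>
      ((v p.1 ^ 2 * v p.2 ^ 2 : ℝ) : ℂ) * (starRingEnd ℂ) (Ssum x (p.1 - p.2))
    have hc : Summable fun p => ‖c p‖ := by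
      refine Summable.of_nonneg_of_le (fun p => by positivity) (fun p => ?_) (hvv.mul_right (m:ℝ))
      simp only [c]
      rw [norm_mul, RCLike.norm_conj, Complex.norm_real, Real.norm_of_nonneg (by positivity)]
      gcongr
      exact norm_Ssum_le _ _
    obtain ⟨y, hy, hyle⟩ := exists_avg c hc (fun p => p.1 - p.2)
    have h0 : (∑' p : (Fin d → ℤ) × (Fin d → ℤ), if p.1 - p.2 = 0 then c p else 0) = 0 := by
      refine (tsum_congr fun p => ?_).trans tsum_zero
      split_ifs with h
      · simp [c, h, Ssum]
      · rfl
    rw [h0, Complex.zero_re] at hyle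
    have hcs : Summable fun p : (Fin d → ℤ) × (Fin d → ℤ) => c p * chi (p.1 - p.2) y := by
      refine Summable.of_norm ?_
      simpa [norm_chi] using hc
    rw [Complex.re_tsum hcs] at hyle
    have hcre := Complex.reCLM.summable hcs
    simp only [Complex.reCLM_apply] at hcre
    refine ⟨Fin.snoc x y, ?_, ?_⟩
    · intro i
      refine Fin.lastCases ?_ (fun i => ?_) i
      · simpa using hy
      · simpa using hx i
    · have hle : ∀ p : (Fin d → ℤ) × (Fin d → ℤ),
          v p.1 ^ 2 * v p.2 ^ 2 * ‖Ssum (Fin.snoc x y : Fin (m+1) → Fin d → ℝ) (p.1 - p.2)‖ ^ 2 ≤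
          v p.1 ^ 2 * v p.2 ^ 2 * ‖Ssum x (p.1 - p.2)‖ ^ 2 +
          2 * (c p * chi (p.1 - p.2) y).re + v p.1 ^ 2 * v p.2 ^ 2 := by
        intro p
        by_cases h : p.1 - p.2 = 0
        · simp [c, h, Ssum]; positivity
        · have e1 : Ssum (Fin.snoc x y : Fin (m+1) → Fin d → ℝ) (p.1 - p.2) =
              Ssum x (p.1 - p.2) + chi (p.1 - p.2) y := by
            simp [Ssum, h, Fin.sum_univ_castSucc]
          have e2 : ‖Ssum x (p.1 - p.2) + chi (p.1 - p.2) y‖ ^ 2 = ‖Ssum x (p.1 - p.2)‖ ^ 2 +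
              2 * ((starRingEnd ℂ) (Ssum x (p.1 - p.2)) * chi (p.1 - p.2) y).re + 1 := by
            have := norm_chi (p.1 - p.2) y
            rw [← Complex.normSq_eq_norm_sq, Complex.normSq_add, Complex.normSq_eq_norm_sq,
              Complex.normSq_eq_norm_sq, this]
            simp only [Complex.mul_re, Complex.conj_re, Complex.conj_im]
            ring
          rw [e1, e2]
          simp only [c]
          rw [mul_assoc ((_ : ℝ) : ℂ), Complex.re_ofReal_mul]
          apply le_of_eq; ring
      have hsum1 := (hvs x).add (hcre.mul_left 2)
      refine ((hvs _).tsum_le_tsum hle (hsum1.add hvv)).trans ?_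
      rw [hsum1.tsum_add hvv, (hvs x).tsum_add (hcre.mul_left 2), tsum_mul_left, hV]
      push_cast
      linarith

/-! ### Point evaluations -/

lemma hasSum_normsq {d : ℕ} (u : Coef d) : HasSum (fun k => ‖u k‖ ^ 2) (‖u‖ ^ 2) := by
  have := lp.hasSum_norm (p := 2) (by norm_num) u
  simpa using this

lemma inv_sq_eq {d : ℕ} (ω : (Fin d → ℤ) → ℝ) (k : Fin d → ℤ) :
    ‖((ω k : ℂ))⁻¹‖ ^ 2 = ((ω k) ^ 2)⁻¹ := by
  rw [norm_inv, Complex.norm_real, inv_pow, Real.norm_eq_abs, sq_abs]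

def dl {d : ℕ} (ω : (Fin d → ℤ) → ℝ) (hs : Summable fun k => ((ω k) ^ 2)⁻¹)
    (x : Fin d → ℝ) : Coef d :=
  ⟨fun k => ((ω k : ℂ))⁻¹ * (starRingEnd ℂ) (chi k x), by
    apply memℓp_gen
    have : ∀ k, ‖((ω k : ℂ))⁻¹ * (starRingEnd ℂ) (chi k x)‖ ^ (ENNReal.toReal 2) =
        ((ω k) ^ 2)⁻¹ := by
      intro k
      rw [norm_mul, RCLike.norm_conj, norm_chi, mul_one]
      simpa using inv_sq_eq ω k
    simpa only [this] using hs⟩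

lemma dl_apply {d : ℕ} (ω : (Fin d → ℤ) → ℝ) (hs : Summable fun k => ((ω k) ^ 2)⁻¹)
    (x : Fin d → ℝ) (k : Fin d → ℤ) :
    (dl ω hs x) k = ((ω k : ℂ))⁻¹ * (starRingEnd ℂ) (chi k x) := rfl

lemma norm_dl {d : ℕ} (ω : (Fin d → ℤ) → ℝ) (hs : Summable fun k => ((ω k) ^ 2)⁻¹)
    (x : Fin d → ℝ) : ‖dl ω hs x‖ ^ 2 = ∑' k, ((ω k) ^ 2)⁻¹ := by
  rw [← (hasSum_normsq (dl ω hs x)).tsum_eq]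
  refine tsum_congr fun k => ?_
  rw [dl_apply, norm_mul, RCLike.norm_conj, norm_chi, mul_one, inv_sq_eq]

lemma torusFn_eq {d : ℕ} (ω : (Fin d → ℤ) → ℝ) (hs : Summable fun k => ((ω k) ^ 2)⁻¹)
    (u : Coef d) (x : Fin d → ℝ) : torusFn ω u x = inner ℂ (dl ω hs x) u := by
  rw [lp.inner_eq_tsum, torusFn]
  refine tsum_congr fun k => ?_
  rw [dl_apply, RCLike.inner_apply, map_mul, Complex.conj_conj, map_inv₀, Complex.conj_ofReal, chi]
  ring

lemma torusFn_eq' {d : ℕ} (ω : (Fin d → ℤ) → ℝ)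
    (u : Coef d) (x : Fin d → ℝ) : torusFn ω u x = ∑' k, ((ω k : ℂ))⁻¹ * u k * chi k x := rfl

lemma summable_coef {d : ℕ} (ω : (Fin d → ℤ) → ℝ) (hs : Summable fun k => ((ω k) ^ 2)⁻¹)
    (u : Coef d) : Summable fun k => ‖((ω k : ℂ))⁻¹ * u k‖ := by
  have := (cs_tsum (fun k => ‖((ω k : ℂ))⁻¹‖) (fun k => ‖u k‖) (fun _ => norm_nonneg _)
    (fun _ => norm_nonneg _) (by simpa only [inv_sq_eq] using hs) (hasSum_normsq u).summable).1
  simpa only [norm_mul] using this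

set_option maxHeartbeats 1000000 in
lemma core {d : ℕ} (ω : (Fin d → ℤ) → ℝ)
    (hs : Summable fun k => ((ω k) ^ 2)⁻¹) (q : ℕ) (hq : 1 ≤ q) (e : ℝ) (he : 0 < e)
    (p : (Fin d → ℤ) → ℝ) (p0 : ∀ k, 0 ≤ p k) (p1 : ∀ k, p k ≤ 1) (hp : Summable p)
    (hpq : ∑' k, p k ≤ q) (hpe : ∑' k, ((ω k) ^ 2)⁻¹ * (1 - p k) ≤ e ^ 2) :
    ∃ x : Fin (64 * q ^ 2) → Fin d → ℝ, (∀ i, x i ∈ cube d) ∧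
      ∀ u : Coef d, (∀ i, torusFn ω u (x i) = 0) → ∀ y, ‖torusFn ω u y‖ ≤ 4 * e * ‖u‖ := by
  classical
  have hq0 : (0:ℝ) < q := by exact_mod_cast hq
  have hσ0 : ∀ k, 0 ≤ ((ω k) ^ 2)⁻¹ := fun k => by positivity
  have hfin : {k | e ^ 2 / q < ((ω k) ^ 2)⁻¹}.Finite := by
    have h := hs.tendsto_cofinite_zero.eventually (gt_mem_nhds (show (0:ℝ) < e ^ 2 / q by positivity))
    have h' : {k | ¬ ((ω k) ^ 2)⁻¹ < e ^ 2 / q}.Finite := h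
    exact h'.subset fun k hk => not_lt.mpr (le_of_lt hk)
  let J := hfin.toFinset
  have hJ : ∀ k, k ∈ J ↔ e ^ 2 / q < ((ω k) ^ 2)⁻¹ := by intro k; simp [J]
  have hsp : Summable fun k => ((ω k) ^ 2)⁻¹ * (1 - p k) := by
    refine Summable.of_nonneg_of_le (fun k => mul_nonneg (hσ0 k) (by linarith [p1 k]))
      (fun k => ?_) hs
    have := hσ0 k
    nlinarith [p0 k]
  have hcard : (J.card : ℝ) ≤ 2 * q := by
    have h1 : ∑ k ∈ J, (e ^ 2 / q) * (1 - p k) ≤ e ^ 2 := by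
      refine le_trans (Finset.sum_le_sum fun k hk => ?_)
        ((hsp.sum_le_tsum J fun k _ => mul_nonneg (hσ0 k) (by linarith [p1 k])).trans hpe)
      exact mul_le_mul_of_nonneg_right ((hJ k).1 hk).le (by linarith [p1 k])
    have h2 : ∑ k ∈ J, p k ≤ q := (hp.sum_le_tsum J fun k _ => p0 k).trans hpq
    rw [← Finset.mul_sum, Finset.sum_sub_distrib] at h1
    simp only [Finset.sum_const, nsmul_eq_mul, mul_one] at h1
    have h3 : (J.card : ℝ) - ∑ k ∈ J, p k ≤ q := by
      rw [div_mul_eq_mul_div, div_le_iff₀ hq0] at h1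
      exact le_of_mul_le_mul_left h1 (by positivity)
    linarith
  let τ : (Fin d → ℤ) → ℝ := fun k => if k ∈ J then 0 else ((ω k) ^ 2)⁻¹
  have hτ0 : ∀ k, 0 ≤ τ k := by
    intro k; simp only [τ]; split_ifs; exacts [le_rfl, hσ0 k]
  have hτs : Summable τ := by
    refine Summable.of_nonneg_of_le hτ0 (fun k => ?_) hs
    simp only [τ]; split_ifs; exacts [hσ0 k, le_rfl]
  have hτ : ∑' k, τ k ≤ 2 * e ^ 2 := by
    have h1 : ∀ k, τ k ≤ ((ω k) ^ 2)⁻¹ * (1 - p k) + (e ^ 2 / q) * p k := by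
      intro k
      simp only [τ]; split_ifs with h
      · exact add_nonneg (mul_nonneg (hσ0 k) (by linarith [p1 k])) (mul_nonneg (by positivity) (p0 k))
      · rw [hJ, not_lt] at h
        have := mul_le_mul_of_nonneg_right h (p0 k)
        linarith
    refine (hτs.tsum_le_tsum h1 (hsp.add (hp.mul_left _))).trans ?_
    rw [hsp.tsum_add (hp.mul_left _), tsum_mul_left]
    have : e ^ 2 / q * ∑' k, p k ≤ e ^ 2 / q * q := by gcongr
    rw [div_mul_cancel₀ _ hq0.ne'] at this
    linarith
  let v : (Fin d → ℤ) → ℝ := fun k =>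
    if k ∈ J then (Real.sqrt (2 * q))⁻¹ else ‖((ω k : ℂ))⁻¹‖ / (Real.sqrt 2 * e)
  have hv0 : ∀ k, 0 ≤ v k := by
    intro k; simp only [v]; split_ifs <;> positivity
  have hsq2 : Real.sqrt 2 ^ 2 = 2 := Real.sq_sqrt (by norm_num)
  have hsqq : Real.sqrt (2 * q) ^ 2 = 2 * q := Real.sq_sqrt (by positivity)
  have hsqq0 : 0 < Real.sqrt (2 * q) := by positivity
  have hv2 : ∀ k, v k ^ 2 = (if k ∈ J then (2 * (q:ℝ))⁻¹ else 0) + (2 * e ^ 2)⁻¹ * τ k := by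
    intro k
    simp only [v, τ]
    split_ifs
    · rw [inv_pow, hsqq]; simp
    · rw [div_pow, mul_pow, hsq2, inv_sq_eq]; simp; ring
  have hJs : HasSum (fun k => if k ∈ J then (2 * (q:ℝ))⁻¹ else 0) (J.card * (2 * (q:ℝ))⁻¹) := by
    have : HasSum (fun k => if k ∈ J then (2 * (q:ℝ))⁻¹ else 0)
        (∑ k ∈ J, if k ∈ J then (2 * (q:ℝ))⁻¹ else 0) :=
      hasSum_sum_of_ne_finset_zero (fun k hk => if_neg hk)
    rw [Finset.sum_congr rfl (fun k hk => if_pos hk)] at this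
    simpa using this
  have hv2s : Summable fun k => v k ^ 2 := by
    simp only [hv2]
    exact hJs.summable.add (hτs.mul_left _)
  have hv2t : ∑' k, v k ^ 2 ≤ 2 := by
    simp only [hv2]
    rw [hJs.summable.tsum_add (hτs.mul_left _), hJs.tsum_eq, tsum_mul_left]
    have a1 : (J.card : ℝ) * (2 * (q:ℝ))⁻¹ ≤ 1 := by
      rw [← div_eq_mul_inv, div_le_one (by positivity)]; exact hcard
    have a2 : (2 * e ^ 2)⁻¹ * ∑' k, τ k ≤ 1 := by
      rw [inv_mul_le_iff₀ (by positivity)]; linarith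
    linarith
  obtain ⟨x, hx, hxS⟩ := greedy v hv2s (64 * q ^ 2)
  refine ⟨x, hx, fun u hu y => ?_⟩
  have hroot : Real.sqrt (∑' p : (Fin d → ℤ) × (Fin d → ℤ),
        v p.1 ^ 2 * v p.2 ^ 2 * ‖Ssum x (p.1 - p.2)‖ ^ 2) ≤ 16 * q := by
    rw [Real.sqrt_le_left (by positivity)]
    refine hxS.trans ?_
    push_cast
    have : (∑' k, v k ^ 2) ^ 2 ≤ 2 ^ 2 := by
      have : 0 ≤ ∑' k, v k ^ 2 := tsum_nonneg fun _ => sq_nonneg _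
      gcongr
    nlinarith [sq_nonneg (q:ℝ)]
  let cg : (Fin d → ℤ) → ℂ := fun k => if k ∈ J then ((ω k : ℂ))⁻¹ * u k else 0
  let ch : (Fin d → ℤ) → ℂ := fun k => if k ∈ J then 0 else ((ω k : ℂ))⁻¹ * u k
  let bg : (Fin d → ℤ) → ℝ := fun k => Real.sqrt (2 * q) * ‖cg k‖
  let bh : (Fin d → ℤ) → ℝ := fun k => if k ∈ J then 0 else Real.sqrt 2 * e * ‖u k‖
  have hcu := summable_coef ω hs u
  have hcg : Summable fun k => ‖cg k‖ := by
    refine Summable.of_nonneg_of_le (fun _ => norm_nonneg _) (fun k => ?_) hcu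
    simp only [cg]; split_ifs <;> simp; positivity
  have hch : Summable fun k => ‖ch k‖ := by
    refine Summable.of_nonneg_of_le (fun _ => norm_nonneg _) (fun k => ?_) hcu
    simp only [ch]; split_ifs <;> simp; positivity
  have hsplit : ∀ z, torusFn ω u z = ∑' k, cg k * chi k z + ∑' k, ch k * chi k z := by
    intro z
    rw [torusFn_eq', ← Summable.tsum_add]
    · refine tsum_congr fun k => ?_
      simp only [cg, ch]; split_ifs <;> simp
    · exact Summable.of_norm (by simpa [norm_chi] using hcg)
    · exact Summable.of_norm (by simpa [norm_chi] using hch)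
  have huS := hasSum_normsq u
  have hcg2 : HasSum (fun k => ‖cg k‖ ^ 2) (∑ k ∈ J, ‖cg k‖ ^ 2) := by
    refine hasSum_sum_of_ne_finset_zero fun k hk => ?_
    simp [cg, hk]
  have hG := expand_bound cg v bg hv0 (fun k => by positivity)
    (fun k => by
      simp only [v, bg]; split_ifs with h
      · rw [inv_mul_cancel_left₀ hsqq0.ne']
      · simp [cg, h])
    hv2s (by simp only [bg, mul_pow]; exact hcg2.summable.mul_left _) x
  have hbh2 : ∀ k, bh k ^ 2 ≤ 2 * e ^ 2 * ‖u k‖ ^ 2 := by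
    intro k
    simp only [bh]; split_ifs
    · simp; positivity
    · rw [mul_pow, mul_pow, hsq2]
  have hbhs : Summable fun k => bh k ^ 2 :=
    Summable.of_nonneg_of_le (fun _ => sq_nonneg _) hbh2 (huS.summable.mul_left _)
  have hH := expand_bound ch v bh hv0 (fun k => by simp only [bh]; split_ifs <;> positivity)
    (fun k => by
      simp only [v, bh, ch]; split_ifs with h
      · simp
      · rw [norm_mul]; field_simp)
    hv2s hbhs x
  have hbht : ∑' k, bh k ^ 2 ≤ 2 * e ^ 2 * ‖u‖ ^ 2 := by
    refine (hbhs.tsum_le_tsum hbh2 (huS.summable.mul_left _)).trans ?_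
    rw [tsum_mul_left, huS.tsum_eq]
  have hch2 : ∀ k, ‖ch k‖ ^ 2 ≤ e ^ 2 / q * ‖u k‖ ^ 2 := by
    intro k
    simp only [ch]; split_ifs with h
    · simp; positivity
    · rw [hJ, not_lt] at h
      rw [norm_mul, mul_pow, inv_sq_eq]
      gcongr
  have hch2s : Summable fun k => ‖ch k‖ ^ 2 :=
    Summable.of_nonneg_of_le (fun _ => sq_nonneg _) hch2 (huS.summable.mul_left _)
  have hcht : ∑' k, ‖ch k‖ ^ 2 ≤ e ^ 2 / q * ‖u‖ ^ 2 := by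
    refine (hch2s.tsum_le_tsum hch2 (huS.summable.mul_left _)).trans ?_
    rw [tsum_mul_left, huS.tsum_eq]
  have hbgt : ∑' k, bg k ^ 2 = 2 * q * ∑ k ∈ J, ‖cg k‖ ^ 2 := by
    simp only [bg, mul_pow, hsqq]
    rw [tsum_mul_left, hcg2.tsum_eq]
  rw [hcg2.tsum_eq, hbgt] at hG
  set G := ∑ k ∈ J, ‖cg k‖ ^ 2 with hGdef
  have hG0 : 0 ≤ G := Finset.sum_nonneg fun _ _ => sq_nonneg _
  have heq : ∑ i, ‖∑' k, cg k * chi k (x i)‖ ^ 2 = ∑ i, ‖∑' k, ch k * chi k (x i)‖ ^ 2 := by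
    refine Finset.sum_congr rfl fun i _ => ?_
    have h := hu i
    rw [hsplit, add_eq_zero_iff_eq_neg] at h
    rw [h, norm_neg]
  rw [heq] at hG
  set X := ∑ i, ‖∑' k, ch k * chi k (x i)‖ ^ 2 with hXdef
  have hX1 : 32 * (q:ℝ) ^ 2 * G ≤ X := by
    have h1 := (abs_le.mp hG).1
    have h2 := mul_le_mul_of_nonneg_left hroot (show 0 ≤ 2 * q * G by positivity)
    push_cast at h1
    nlinarith
  have hX2 : X ≤ 96 * q * e ^ 2 * ‖u‖ ^ 2 := by
    have h1 := (abs_le.mp hH).2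
    have h2 := mul_le_mul hbht hroot (Real.sqrt_nonneg _) (by positivity)
    have h3 := mul_le_mul_of_nonneg_left hcht (show (0:ℝ) ≤ 64 * q ^ 2 by positivity)
    have h4 : 64 * (q:ℝ) ^ 2 * (e ^ 2 / q * ‖u‖ ^ 2) = 64 * q * e ^ 2 * ‖u‖ ^ 2 := by
      field_simp
    push_cast at h1
    nlinarith
  have hGle : q * G ≤ 3 * e ^ 2 * ‖u‖ ^ 2 := by
    have : (32 * (q:ℝ)) * (q * G) ≤ (32 * q) * (3 * e ^ 2 * ‖u‖ ^ 2) := by nlinarith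
    exact le_of_mul_le_mul_left this (by positivity)
  -- sup bounds
  have hgy : ‖∑' k, cg k * chi k y‖ ≤ Real.sqrt 6 * (e * ‖u‖) := by
    have h1 : ∑' k, cg k * chi k y = ∑ k ∈ J, cg k * chi k y :=
      tsum_eq_sum fun k hk => by simp [cg, hk]
    rw [h1]
    refine (norm_sum_le _ _).trans ?_
    simp only [norm_mul, norm_chi, mul_one]
    refine abs_le_of_sq_le_sq' ?_ (by positivity) |>.2
    refine sq_sum_le_card_mul_sum_sq.trans ?_
    rw [mul_pow, mul_pow, Real.sq_sqrt (by norm_num)]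
    have : (J.card : ℝ) * G ≤ 2 * q * G := by gcongr
    linarith
  have hhy : ‖∑' k, ch k * chi k y‖ ≤ Real.sqrt 2 * (e * ‖u‖) := by
    refine (norm_tsum_le_tsum_norm (by simpa [norm_chi] using hch)).trans ?_
    simp only [norm_mul, norm_chi, mul_one]
    have hτ2 : ∀ k, (Real.sqrt (τ k)) ^ 2 = τ k := fun k => Real.sq_sqrt (hτ0 k)
    have h := cs_tsum (fun k => Real.sqrt (τ k)) (fun k => ‖u k‖) (fun _ => Real.sqrt_nonneg _)
      (fun _ => norm_nonneg _) (by simpa only [hτ2] using hτs) huS.summable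
    simp only [hτ2, huS.tsum_eq] at h
    rw [Real.sqrt_sq (norm_nonneg _)] at h
    have e1 : ∀ k, ‖ch k‖ = Real.sqrt (τ k) * ‖u k‖ := by
      intro k
      simp only [ch, τ]; split_ifs
      · simp
      · rw [norm_mul, ← inv_sq_eq, Real.sqrt_sq (norm_nonneg _)]
    simp only [e1]
    refine h.2.trans ?_
    rw [← mul_assoc]
    gcongr
    rw [Real.sqrt_le_left (by positivity), mul_pow, hsq2]
    exact hτ
  rw [hsplit]
  refine (norm_add_le _ _).trans ?_
  have s6 : Real.sqrt 6 ≤ 2.5 := by rw [Real.sqrt_le_left (by norm_num)]; norm_num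
  have s2 : Real.sqrt 2 ≤ 1.5 := by rw [Real.sqrt_le_left (by norm_num)]; norm_num
  have : 0 ≤ e * ‖u‖ := by positivity
  nlinarith

lemma nn_eq (z : ℂ) : (‖z‖₊ : ℝ≥0∞) = ENNReal.ofReal ‖z‖ := (ofReal_norm z).symm

/-! ### Upper bound for standard information -/

lemma wcErr_std_le {d : ℕ} (ω : (Fin d → ℤ) → ℝ)
    (hs : Summable fun k => ((ω k) ^ 2)⁻¹) (q : ℕ) (hq : 1 ≤ q) (e : ℝ) (he : 0 < e)
    (p : (Fin d → ℤ) → ℝ) (p0 : ∀ k, 0 ≤ p k) (p1 : ∀ k, p k ≤ 1) (hp : Summable p)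
    (hpq : ∑' k, p k ≤ q) (hpe : ∑' k, ((ω k) ^ 2)⁻¹ * (1 - p k) ≤ e ^ 2) :
    wcErr ω (stdInfo ω) (64 * q ^ 2) ≤ ENNReal.ofReal (8 * e) := by
  classical
  obtain ⟨x, hx, hu⟩ := core ω hs q hq e he p p0 p1 hp hpq hpe
  unfold wcErr
  refine iInf_le_of_le (fun i u => torusFn ω u (x i)) ?_
  refine iInf_le_of_le (fun i => ⟨x i, hx i, rfl⟩) ?_
  refine iInf_le_of_le (fun D y =>
    if h : ∃ u : Coef d, ‖u‖ ≤ 1 ∧ (fun i => torusFn ω u (x i)) = D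
    then torusFn ω h.choose y else 0) ?_
  refine iSup_le fun u => iSup_le fun hu1 => iSup_le fun y => iSup_le fun hy => ?_
  have hex : ∃ u' : Coef d, ‖u'‖ ≤ 1 ∧ (fun i => torusFn ω u' (x i)) =
    fun i => torusFn ω u (x i) := ⟨u, hu1, rfl⟩
  beta_reduce
  rw [dif_pos hex]
  obtain ⟨h1, h2⟩ := hex.choose_spec
  set u' := hex.choose
  have hsub : ∀ z, torusFn ω (u - u') z = torusFn ω u z - torusFn ω u' z := by
    intro z
    rw [torusFn_eq ω hs, torusFn_eq ω hs, torusFn_eq ω hs, inner_sub_right]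
  have h3 := hu (u - u') (fun i => by
    rw [hsub, sub_eq_zero]; exact (congrFun h2 i).symm) y
  rw [hsub] at h3
  have h4 : ‖u - u'‖ ≤ 2 := (norm_sub_le _ _).trans (by linarith)
  have h5 : ‖torusFn ω u y - torusFn ω u' y‖ ≤ 8 * e := by
    refine h3.trans ?_
    nlinarith
  rw [nn_eq]
  exact ENNReal.ofReal_le_ofReal h5

/-! ### Lower bound for general information -/

lemma proj_facts {E : Type} [NormedAddCommGroup E] [InnerProductSpace ℂ E] {m : ℕ}
    (V : Fin m → E) (hV : Orthonormal ℂ V) (δ : E) :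
    ∃ w : E, (∀ i, inner ℂ (V i) w = 0) ∧ inner ℂ δ w = ((‖w‖ ^ 2 : ℝ) : ℂ) ∧
      ‖w‖ ^ 2 = ‖δ‖ ^ 2 - ∑ i, ‖inner ℂ δ (V i)‖ ^ 2 := by
  let w := δ - ∑ i, inner ℂ (V i) δ • V i
  have h1 : ∀ i, inner ℂ (V i) w = 0 := by
    intro i
    simp only [w]
    rw [inner_sub_right, hV.inner_right_fintype, sub_self]
  have h2 : inner ℂ δ w = ((‖w‖ ^ 2 : ℝ) : ℂ) := by
    have h := inner_self_eq_norm_sq_to_K (𝕜 := ℂ) w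
    have h' : inner ℂ w w = inner ℂ δ w := by
      conv_lhs => arg 2; simp only [w]
      rw [inner_sub_left, sum_inner]
      simp [inner_smul_left, h1]
    rw [← h', h]
    push_cast; rfl
  refine ⟨w, h1, h2, ?_⟩
  have h3 : inner ℂ δ w = ((‖δ‖ ^ 2 - ∑ i, ‖inner ℂ δ (V i)‖ ^ 2 : ℝ) : ℂ) := by
    simp only [w]
    rw [inner_sub_right, inner_sum, inner_self_eq_norm_sq_to_K]
    push_cast
    congr 1
    refine Finset.sum_congr rfl fun i _ => ?_
    rw [inner_smul_right, ← inner_conj_symm, mul_comm, Complex.mul_conj, Complex.normSq_eq_norm_sq]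
    push_cast; rfl
  rw [h2] at h3
  exact_mod_cast h3

set_option maxHeartbeats 1000000 in
lemma lower {d : ℕ} (ω : (Fin d → ℤ) → ℝ)
    (hs : Summable fun k => ((ω k) ^ 2)⁻¹) (n : ℕ) (e : ℝ) (he : 0 < e)
    (hn : wcErr ω (allInfo d) n < ENNReal.ofReal e) :
    ∃ p : (Fin d → ℤ) → ℝ, (∀ k, 0 ≤ p k) ∧ (∀ k, p k ≤ 1) ∧ Summable p ∧
      ∑' k, p k ≤ n ∧ ∑' k, ((ω k) ^ 2)⁻¹ * (1 - p k) ≤ e ^ 2 := by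
  classical
  unfold wcErr at hn
  simp only [iInf_lt_iff] at hn
  obtain ⟨L, hL, φ, hφ⟩ := hn
  have hφ' : ∀ u : Coef d, ‖u‖ ≤ 1 → ∀ x ∈ cube d,
      ‖torusFn ω u x - φ (fun i => L i u) x‖ ≤ e := by
    intro u hu x hx
    have h := hφ.le
    simp only [iSup_le_iff] at h
    have h := h u hu x hx
    rw [nn_eq] at h
    exact (ENNReal.ofReal_le_ofReal_iff he.le).1 h
  choose T hT using hL
  let r : Fin n → Coef d := fun i => (InnerProductSpace.toDual ℂ (Coef d)).symm (T i)
  have hr : ∀ i u, L i u = inner ℂ (r i) u := by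
    intro i u
    rw [hT i, InnerProductSpace.toDual_symm_apply]
  let W : Submodule ℂ (Coef d) := Submodule.span ℂ (Set.range r)
  have : FiniteDimensional ℂ W := FiniteDimensional.span_of_finite ℂ (Set.finite_range r)
  have hdim : Module.finrank ℂ W ≤ n := by
    have := finrank_range_le_card (R := ℂ) r
    simpa [Set.finrank, W] using this
  let v := stdOrthonormalBasis ℂ W
  let V : Fin (Module.finrank ℂ W) → Coef d := fun i => (v i : Coef d)
  have hV : Orthonormal ℂ V := v.orthonormal.comp_linearIsometry W.subtypeₗᵢ
  have hVW : ∀ w : Coef d, (∀ i, inner ℂ (V i) w = 0) → ∀ i, L i w = 0 := by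
    intro w hw i
    rw [hr]
    have hmem : r i ∈ W := Submodule.subset_span ⟨i, rfl⟩
    have h := congrArg (Subtype.val) (v.sum_repr ⟨r i, hmem⟩)
    rw [Submodule.coe_sum] at h
    simp only at h
    rw [← h, sum_inner]
    refine Finset.sum_eq_zero fun j _ => ?_
    rw [Submodule.coe_smul, inner_smul_left]
    have := hw j
    simp only [V] at this
    rw [this, mul_zero]
  have hker : ∀ w : Coef d, (∀ i, L i w = 0) → ∀ x ∈ cube d, ‖torusFn ω w x‖ ≤ e * ‖w‖ := by
    intro w hw x hx
    rcases eq_or_ne w 0 with rfl | hw0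
    · rw [torusFn_eq ω hs]; simp
    have hwn : 0 < ‖w‖ := norm_pos_iff.mpr hw0
    let u : Coef d := ((‖w‖⁻¹ : ℝ) : ℂ) • w
    have hu1 : ‖u‖ = 1 := by
      simp only [u]
      rw [norm_smul, Complex.norm_real, norm_inv, norm_norm, inv_mul_cancel₀ hwn.ne']
    have hLu : (fun i => L i u) = fun _ => 0 := by
      funext i
      simp only [u]
      rw [hr, inner_smul_right, ← hr, hw, mul_zero]
    have hLnu : (fun i => L i (-u)) = fun _ => 0 := by
      funext i
      rw [hr, inner_neg_right, ← hr, congrFun hLu i, neg_zero]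
    have a1 := hφ' u hu1.le x hx
    have a2 := hφ' (-u) (by rw [norm_neg]; exact hu1.le) x hx
    rw [hLu] at a1
    rw [hLnu] at a2
    have a3 : torusFn ω (-u) x = - torusFn ω u x := by
      rw [torusFn_eq ω hs, torusFn_eq ω hs, inner_neg_right]
    have a4 : torusFn ω w x = (‖w‖ : ℂ) * torusFn ω u x := by
      rw [torusFn_eq ω hs, torusFn_eq ω hs]
      simp only [u]
      rw [inner_smul_right, ← mul_assoc, ← Complex.ofReal_mul, mul_inv_cancel₀ hwn.ne']
      simp
    rw [a3] at a2
    have a5 : ‖torusFn ω u x‖ ≤ e := by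
      have : torusFn ω u x = (1/2 : ℂ) * ((torusFn ω u x - φ (fun _ => 0) x) -
        (-torusFn ω u x - φ (fun _ => 0) x)) := by ring
      rw [this, norm_mul]
      have h6 := (norm_sub_le (torusFn ω u x - φ (fun _ => 0) x)
        (-torusFn ω u x - φ (fun _ => 0) x))
      have h7 : ‖(1/2 : ℂ)‖ = 1/2 := by norm_num
      rw [h7]
      linarith
    rw [a4, norm_mul, Complex.norm_real, norm_norm, mul_comm]
    gcongr
  have hpt : ∀ x ∈ cube d, ∑' k, ((ω k) ^ 2)⁻¹ - ∑ i, ‖torusFn ω (V i) x‖ ^ 2 ≤ e ^ 2 := by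
    intro x hx
    obtain ⟨w, hw1, hw2, hw3⟩ := proj_facts V hV (dl ω hs x)
    have h := hker w (hVW w hw1) x hx
    rw [torusFn_eq ω hs, hw2, Complex.norm_real, Real.norm_of_nonneg (sq_nonneg _)] at h
    have hwe : ‖w‖ ≤ e := by
      by_contra hc
      push Not at hc
      nlinarith [norm_nonneg w]
    rw [norm_dl] at hw3
    simp only [torusFn_eq ω hs]
    rw [← hw3]
    have := norm_nonneg w
    gcongr
  have hVs : ∀ i, HasSum (fun k => ‖V i k‖ ^ 2) 1 := by
    intro i
    have := hasSum_normsq (V i)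
    rwa [hV.1 i, one_pow] at this
  let c : Fin (Module.finrank ℂ W) → (Fin d → ℤ) → ℂ := fun i k => ((ω k : ℂ))⁻¹ * V i k
  have hcs : ∀ i, Summable fun k => ‖c i k‖ := fun i => summable_coef ω hs (V i)
  obtain ⟨x, hx, hxle⟩ := exists_avg (d := d)
    (fun p : (Fin d → ℤ) × (Fin d → ℤ) => ∑ i, c i p.1 * (starRingEnd ℂ) (c i p.2))
    (by
      refine Summable.of_nonneg_of_le (fun _ => norm_nonneg _) (fun p => norm_sum_le _ _) ?_
      exact summable_sum fun i _ => summable_pair (c i) (hcs i))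
    (fun p => p.1 - p.2)
  have hl : (∑' p : (Fin d → ℤ) × (Fin d → ℤ),
      (∑ i, c i p.1 * (starRingEnd ℂ) (c i p.2)) * chi (p.1 - p.2) x).re =
      ∑ i, ‖torusFn ω (V i) x‖ ^ 2 := by
    simp only [Finset.sum_mul]
    rw [Summable.tsum_finsetSum]
    · simp only [← normsq_expand _ (hcs _)]
      rw [← Complex.ofReal_sum, Complex.ofReal_re]
      rfl
    · intro i _
      refine Summable.of_norm_bounded (summable_pair (c i) (hcs i)) fun p => ?_
      rw [norm_mul, norm_chi, mul_one]
  have hrr : (∑' p : (Fin d → ℤ) × (Fin d → ℤ), if p.1 - p.2 = 0 then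
      (∑ i, c i p.1 * (starRingEnd ℂ) (c i p.2)) else 0).re =
      ∑ i, ∑' k, ‖c i k‖ ^ 2 := by
    have h1 : ∀ p : (Fin d → ℤ) × (Fin d → ℤ), (if p.1 - p.2 = 0 then
      (∑ i, c i p.1 * (starRingEnd ℂ) (c i p.2)) else 0) =
      ∑ i, if p.1 - p.2 = 0 then c i p.1 * (starRingEnd ℂ) (c i p.2) else 0 := by
      intro p; split_ifs <;> simp
    simp only [h1]
    rw [Summable.tsum_finsetSum]
    · simp only [diag_sum _ (hcs _)]
      rw [← Complex.ofReal_sum, Complex.ofReal_re]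
    · intro i _
      refine Summable.of_norm_bounded (summable_pair (c i) (hcs i)) fun p => ?_
      split_ifs <;> simp
      positivity
  rw [hl, hrr] at hxle
  have p0 : ∀ k, 0 ≤ ∑ i, ‖V i k‖ ^ 2 := fun k => Finset.sum_nonneg fun _ _ => sq_nonneg _
  have p1 : ∀ k, ∑ i, ‖V i k‖ ^ 2 ≤ 1 := by
    intro k
    have h := hV.sum_inner_products_le (lp.single 2 k (1:ℂ) : Coef d) (s := Finset.univ)
    rw [lp.norm_single (by norm_num)] at h
    simpa [lp.inner_single_right] using h
  have hp : HasSum (fun k => ∑ i, ‖V i k‖ ^ 2) (∑ _i : Fin (Module.finrank ℂ W), (1:ℝ)) :=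
    hasSum_sum fun i _ => hVs i
  refine ⟨fun k => ∑ i, ‖V i k‖ ^ 2, p0, p1, hp.summable, ?_, ?_⟩
  · rw [hp.tsum_eq]; simpa using hdim
  · have hσ0 : ∀ k, 0 ≤ ((ω k) ^ 2)⁻¹ := fun k => by positivity
    have hc2 : ∀ i k, ‖c i k‖ ^ 2 = ((ω k) ^ 2)⁻¹ * ‖V i k‖ ^ 2 := by
      intro i k
      simp only [c]
      rw [norm_mul, mul_pow, inv_sq_eq]
    have hc2s : ∀ i, Summable fun k => ((ω k) ^ 2)⁻¹ * ‖V i k‖ ^ 2 := by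
      intro i
      refine Summable.of_nonneg_of_le (fun k => mul_nonneg (hσ0 k) (sq_nonneg _)) (fun k => ?_) hs
      have : ‖V i k‖ ^ 2 ≤ 1 := le_hasSum (hVs i) k fun _ _ => sq_nonneg _
      have := hσ0 k
      nlinarith
    have h2 : ∑' k, ((ω k) ^ 2)⁻¹ * (1 - ∑ i, ‖V i k‖ ^ 2) =
        ∑' k, ((ω k) ^ 2)⁻¹ - ∑ i, ∑' k, ‖c i k‖ ^ 2 := by
      simp only [hc2]
      rw [← Summable.tsum_finsetSum fun i _ => hc2s i, ← hs.tsum_sub (summable_sum fun i _ => hc2s i)]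
      refine tsum_congr fun k => ?_
      rw [mul_sub, mul_one, Finset.mul_sum]
    rw [h2]
    have := hpt x hx
    linarith

/-! ### Comparison of information complexities -/

lemma std_sub_all {d : ℕ} (ω : (Fin d → ℤ) → ℝ)
    (hs : Summable fun k => ((ω k) ^ 2)⁻¹) : stdInfo ω ⊆ allInfo d := by
  rintro L ⟨x, _, rfl⟩
  refine ⟨innerSL ℂ (dl ω hs x), ?_⟩
  funext u
  rw [torusFn_eq ω hs]; rfl

lemma wcErr_mono {d : ℕ} (ω : (Fin d → ℤ) → ℝ)
    (hs : Summable fun k => ((ω k) ^ 2)⁻¹) (n : ℕ) :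
    wcErr ω (allInfo d) n ≤ wcErr ω (stdInfo ω) n := by
  unfold wcErr
  refine iInf_mono fun L => ?_
  refine le_iInf fun h => ?_
  exact iInf_le_of_le (fun i => std_sub_all ω hs (h i)) le_rfl

lemma cri_pos {d : ℕ} (ω : (Fin d → ℤ) → ℝ) (hpos : ∀ k, 0 < ω k)
    (hs : Summable fun k => ((ω k) ^ 2)⁻¹) (crit : Crit) :
    ∃ κ : ℝ, 0 < κ ∧ CRI ω crit = ENNReal.ofReal κ := by
  classical
  cases crit with
  | ABS => exact ⟨1, one_pos, by simp [CRI]⟩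
  | NOR =>
    have htop : initErr ω ≤ ENNReal.ofReal (Real.sqrt (∑' k, ((ω k) ^ 2)⁻¹)) := by
      unfold initErr
      refine iSup_le fun u => iSup_le fun hu1 => iSup_le fun y => iSup_le fun hy => ?_
      rw [nn_eq]
      apply ENNReal.ofReal_le_ofReal
      rw [torusFn_eq ω hs, ← norm_dl ω hs y, Real.sqrt_sq (norm_nonneg _)]
      refine (norm_inner_le_norm _ _).trans ?_
      nlinarith [norm_nonneg (dl ω hs y)]
    have hne : initErr ω ≠ ⊤ := ne_top_of_le_ne_top ENNReal.ofReal_ne_top htop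
    have h0 : 0 < initErr ω := by
      have h1 : ENNReal.ofReal ((ω 0)⁻¹) ≤ initErr ω := by
        unfold initErr
        refine le_iSup_of_le (lp.single 2 0 (1:ℂ) : Coef d) ?_
        refine le_iSup_of_le (by rw [lp.norm_single (by norm_num)]; simp) ?_
        refine le_iSup_of_le 0 ?_
        refine le_iSup_of_le (fun j => by simp) ?_
        rw [nn_eq]
        apply ENNReal.ofReal_le_ofReal
        rw [torusFn_eq ω hs, lp.inner_single_right, dl_apply, RCLike.inner_apply]
        rw [norm_mul, RCLike.norm_conj, norm_mul, RCLike.norm_conj, norm_chi, norm_inv,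
          Complex.norm_real, Real.norm_of_nonneg (hpos 0).le]
        simp
      exact lt_of_lt_of_le (ENNReal.ofReal_pos.mpr (inv_pos.mpr (hpos 0))) h1
    refine ⟨(initErr ω).toReal, ENNReal.toReal_pos h0.ne' hne, ?_⟩
    rw [ENNReal.ofReal_toReal hne]; rfl

lemma std_nonempty {d : ℕ} (ω : (Fin d → ℤ) → ℝ)
    (hs : Summable fun k => ((ω k) ^ 2)⁻¹) (e : ℝ) (he : 0 < e) :
    ∃ n, wcErr ω (stdInfo ω) n ≤ ENNReal.ofReal (8 * e) := by
  classical
  obtain ⟨s, hsle⟩ : ∃ s : Finset (Fin d → ℤ),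
      ∑' k, ((ω k) ^ 2)⁻¹ - e ^ 2 < ∑ k ∈ s, ((ω k) ^ 2)⁻¹ := by
    have h : Tendsto (fun s : Finset (Fin d → ℤ) => ∑ k ∈ s, ((ω k) ^ 2)⁻¹) atTop
      (nhds (∑' k, ((ω k) ^ 2)⁻¹)) := hs.hasSum
    exact (h.eventually (lt_mem_nhds (show ∑' k, ((ω k) ^ 2)⁻¹ - e ^ 2 < ∑' k, ((ω k) ^ 2)⁻¹ by
      have : 0 < e ^ 2 := by positivity
      linarith))).exists
  have hp : HasSum (fun k => if k ∈ s then (1:ℝ) else 0) (∑ k ∈ s, if k ∈ s then (1:ℝ) else 0) :=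
    hasSum_sum_of_ne_finset_zero fun k hk => if_neg hk
  have hp2 : HasSum (fun k => if k ∈ s then ((ω k) ^ 2)⁻¹ else 0)
      (∑ k ∈ s, if k ∈ s then ((ω k) ^ 2)⁻¹ else 0) :=
    hasSum_sum_of_ne_finset_zero fun k hk => if_neg hk
  refine ⟨_, wcErr_std_le ω hs (s.card + 1) (by omega) e he (fun k => if k ∈ s then 1 else 0)
    (fun k => by split_ifs <;> norm_num) (fun k => by split_ifs <;> norm_num) hp.summable ?_ ?_⟩
  · rw [hp.tsum_eq, Finset.sum_congr rfl (fun k hk => if_pos hk)]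
    simp
  · have h1 : ∀ k, ((ω k) ^ 2)⁻¹ * (1 - if k ∈ s then 1 else 0) =
        ((ω k) ^ 2)⁻¹ - if k ∈ s then ((ω k) ^ 2)⁻¹ else 0 := by
      intro k; split_ifs <;> simp
    simp only [h1]
    rw [hs.tsum_sub hp2.summable, hp2.tsum_eq, Finset.sum_congr rfl (fun k hk => if_pos hk)]
    linarith

lemma infoComp_all_le {d : ℕ} (ω : (Fin d → ℤ) → ℝ) (hpos : ∀ k, 0 < ω k)
    (hs : Summable fun k => ((ω k) ^ 2)⁻¹) (crit : Crit) (ε : ℝ) (hε : 0 < ε) :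
    infoComp ω (allInfo d) crit ε ≤ infoComp ω (stdInfo ω) crit ε := by
  obtain ⟨κ, hκ, hC⟩ := cri_pos ω hpos hs crit
  have hne : {n : ℕ | wcErr ω (stdInfo ω) n ≤ ENNReal.ofReal ε * CRI ω crit}.Nonempty := by
    obtain ⟨n, hn⟩ := std_nonempty ω hs (ε * κ / 8) (by positivity)
    refine ⟨n, ?_⟩
    rw [Set.mem_setOf_eq, hC, ← ENNReal.ofReal_mul hε.le]
    rwa [mul_div_cancel₀ _ (by norm_num : (8:ℝ) ≠ 0)] at hn
  exact Nat.sInf_le ((wcErr_mono ω hs _).trans (Nat.sInf_mem hne))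

lemma infoComp_std_le {d : ℕ} (ω : (Fin d → ℤ) → ℝ) (hpos : ∀ k, 0 < ω k)
    (hs : Summable fun k => ((ω k) ^ 2)⁻¹) (crit : Crit) (ε : ℝ) (hε : 0 < ε) :
    infoComp ω (stdInfo ω) crit ε ≤ 64 * (infoComp ω (allInfo d) crit (ε / 16) + 1) ^ 2 := by
  obtain ⟨κ, hκ, hC⟩ := cri_pos ω hpos hs crit
  have hne : {n : ℕ | wcErr ω (allInfo d) n ≤ ENNReal.ofReal (ε / 16) * CRI ω crit}.Nonempty := by
    obtain ⟨n, hn⟩ := std_nonempty ω hs (ε / 16 * κ / 8) (by positivity)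
    refine ⟨n, ?_⟩
    rw [Set.mem_setOf_eq, hC, ← ENNReal.ofReal_mul (by positivity)]
    rw [mul_div_cancel₀ _ (by norm_num : (8:ℝ) ≠ 0)] at hn
    exact (wcErr_mono ω hs _).trans hn
  have hmem := Nat.sInf_mem hne
  change wcErr ω (allInfo d) (infoComp ω (allInfo d) crit (ε / 16)) ≤ _ at hmem
  set n := infoComp ω (allInfo d) crit (ε / 16)
  rw [hC, ← ENNReal.ofReal_mul (by positivity)] at hmem
  have he : 0 < ε * κ / 8 := by positivity
  have hlt : wcErr ω (allInfo d) n < ENNReal.ofReal (ε * κ / 8) := by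
    refine lt_of_le_of_lt hmem ((ENNReal.ofReal_lt_ofReal_iff he).mpr ?_)
    have : 0 < ε * κ := by positivity
    linarith
  obtain ⟨p, p0, p1, hp, hpn, hpe⟩ := lower ω hs n _ he hlt
  have h := wcErr_std_le ω hs (n + 1) (by omega) _ he p p0 p1 hp
    (hpn.trans (by push_cast; linarith)) hpe
  refine Nat.sInf_le ?_
  rw [Set.mem_setOf_eq, hC, ← ENNReal.ofReal_mul hε.le]
  rwa [mul_div_cancel₀ _ (by norm_num : (8:ℝ) ≠ 0)] at h

/-! ### Tractability -/

lemma den_pos (s t : ℝ) (d : ℕ) (ε : ℝ) (hε : ε ∈ Set.Ioo (0:ℝ) 1) :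
    0 < (1 + Real.log ε⁻¹) ^ s + (d : ℝ) ^ t := by
  have : 0 ≤ Real.log ε⁻¹ := Real.log_nonneg ((one_le_inv₀ hε.1).mpr hε.2.le)
  have h1 : 0 < (1 + Real.log ε⁻¹) ^ s := Real.rpow_pos_of_pos (by linarith) _
  have h2 : 0 ≤ (d : ℝ) ^ t := by positivity
  linarith

lemma log_nat_mono {a b : ℕ} (h : a ≤ b) : Real.log a ≤ Real.log b := by
  rcases Nat.eq_zero_or_pos a with rfl | ha
  · simpa using Real.log_natCast_nonneg b
  · exact Real.log_le_log (by exact_mod_cast ha) (by exact_mod_cast h)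

lemma wt_of_le (s t : ℝ) (A B : ℕ → ℝ → ℕ)
    (hAB : ∀ d, 0 < d → ∀ ε, 0 < ε → A d ε ≤ B d ε) (h : EXPWTst s t B) : EXPWTst s t A := by
  intro δ hδ
  obtain ⟨M, hM⟩ := h δ hδ
  refine ⟨M, fun d hd ε hε hle => lt_of_le_of_lt ?_ (hM d hd ε hε hle)⟩
  have hden := den_pos s t d ε hε
  rw [abs_of_nonneg (div_nonneg (Real.log_natCast_nonneg _) hden.le),
    abs_of_nonneg (div_nonneg (Real.log_natCast_nonneg _) hden.le)]
  exact div_le_div_of_nonneg_right (log_nat_mono (hAB d hd ε hε.1)) hden.le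

lemma den_large (s t : ℝ) (hs : 0 < s) (ht : 0 < t) (R : ℝ) :
    ∃ M : ℝ, ∀ d : ℕ, ∀ ε ∈ Set.Ioo (0:ℝ) 1, M ≤ ε⁻¹ + d →
      R ≤ (1 + Real.log ε⁻¹) ^ s + (d : ℝ) ^ t := by
  have h1 : Tendsto (fun y : ℝ => (1 + Real.log y) ^ s) atTop atTop :=
    (tendsto_rpow_atTop hs).comp (tendsto_atTop_add_const_left _ _ Real.tendsto_log_atTop)
  have h2 : Tendsto (fun y : ℝ => y ^ t) atTop atTop := tendsto_rpow_atTop ht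
  obtain ⟨Y1, hY1⟩ := (h1.eventually_ge_atTop R).exists_forall_of_atTop
  obtain ⟨Y2, hY2⟩ := (h2.eventually_ge_atTop R).exists_forall_of_atTop
  refine ⟨Y1 + Y2, fun d ε hε hle => ?_⟩
  have : 0 ≤ Real.log ε⁻¹ := Real.log_nonneg ((one_le_inv₀ hε.1).mpr hε.2.le)
  have a1 : 0 < (1 + Real.log ε⁻¹) ^ s := Real.rpow_pos_of_pos (by linarith) _
  have a2 : 0 ≤ (d : ℝ) ^ t := by positivity
  rcases le_or_gt Y1 ε⁻¹ with h | h
  · have := hY1 _ h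
    linarith
  · have := hY2 d (by linarith)
    linarith

lemma wt_of_poly (s t : ℝ) (hs : 0 < s) (ht : 0 < t) (A B : ℕ → ℝ → ℕ)
    (hAB : ∀ d, 0 < d → ∀ ε, 0 < ε → B d ε ≤ 64 * (A d (ε / 16) + 1) ^ 2)
    (h : EXPWTst s t A) : EXPWTst s t B := by
  intro δ hδ
  have hl16 : 0 < Real.log 16 := Real.log_pos (by norm_num)
  let K : ℝ := (1 + Real.log 16) ^ s
  have hK : 1 ≤ K := Real.one_le_rpow (by linarith) hs.le
  obtain ⟨M1, hM1⟩ := h (δ / (4 * K)) (by positivity)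
  obtain ⟨M2, hM2⟩ := den_large s t hs ht (2 * Real.log 256 / δ)
  refine ⟨max M1 M2, fun d hd ε hε hle => ?_⟩
  have hε' : ε / 16 ∈ Set.Ioo (0:ℝ) 1 := ⟨by have := hε.1; positivity, by linarith [hε.2, hε.1]⟩
  have hinv : (ε / 16)⁻¹ = 16 * ε⁻¹ := by rw [inv_div]; rfl
  have hεi : 0 < ε⁻¹ := inv_pos.mpr hε.1
  have b1 := hM1 d hd (ε / 16) hε' (by
    rw [hinv]; have := le_max_left M1 M2; linarith)
  have b2 := hM2 d ε hε ((le_max_right M1 M2).trans hle)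
  have hden := den_pos s t d ε hε
  have hden' := den_pos s t d (ε / 16) hε'
  simp only at b1 ⊢
  have hL : 0 ≤ Real.log ε⁻¹ := Real.log_nonneg ((one_le_inv₀ hε.1).mpr hε.2.le)
  have hdd : (1 + Real.log (ε / 16)⁻¹) ^ s + (d : ℝ) ^ t ≤
      K * ((1 + Real.log ε⁻¹) ^ s + (d : ℝ) ^ t) := by
    have c1 : (1 + Real.log (ε / 16)⁻¹) ^ s ≤ K * (1 + Real.log ε⁻¹) ^ s := by
      simp only [K]
      rw [← Real.mul_rpow (by linarith) (by linarith), hinv,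
        Real.log_mul (by norm_num) hεi.ne']
      apply Real.rpow_le_rpow (by linarith) _ hs.le
      nlinarith
    have c2 : (d : ℝ) ^ t ≤ K * (d : ℝ) ^ t := le_mul_of_one_le_left (by positivity) hK
    linarith
  rw [abs_of_nonneg (div_nonneg (Real.log_natCast_nonneg _) hden'.le), div_lt_iff₀ hden'] at b1
  rw [abs_of_nonneg (div_nonneg (Real.log_natCast_nonneg _) hden.le), div_lt_iff₀ hden]
  set D := (1 + Real.log ε⁻¹) ^ s + (d : ℝ) ^ t
  have b3 : Real.log (A d (ε / 16)) < δ / 4 * D := by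
    refine b1.trans_le ?_
    refine (mul_le_mul_of_nonneg_left hdd (by positivity)).trans (le_of_eq ?_)
    field_simp
  have b4 : Real.log 256 ≤ δ / 2 * D := by
    rw [div_le_iff₀ hδ] at b2; linarith
  have b5 : Real.log (B d ε) ≤ Real.log 256 + 2 * Real.log (A d (ε / 16)) := by
    refine (log_nat_mono (hAB d hd ε hε.1)).trans ?_
    rcases Nat.eq_zero_or_pos (A d (ε / 16)) with h0 | h0
    · rw [h0]
      simp only [Nat.cast_zero, Real.log_zero, mul_zero, add_zero]
      norm_num
      exact Real.log_le_log (by norm_num) (by norm_num)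
    · have h1 : (1:ℝ) ≤ A d (ε / 16) := by exact_mod_cast h0
      have h2 : (2:ℝ) * Real.log (A d (ε / 16)) = Real.log ((A d (ε / 16) : ℝ) ^ 2) := by
        rw [Real.log_pow]; norm_num
      rw [h2, ← Real.log_mul (by norm_num) (by positivity)]
      apply Real.log_le_log (by positivity)
      push_cast
      nlinarith
  linarith

/-- For fixed `s, t > 0`, EXP-`(s,t)`-WT for `Λ^all` is equivalent to
EXP-`(s,t)`-WT for `Λ^std`; in particular (s = t = 1) EXP-WT for `Λ^all` is equivalent to
EXP-WT for `Λ^std`, for the absolute or normalized error criterion. -/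
theorem stmt6
    (ω : (d : ℕ) → (Fin d → ℤ) → ℝ)
    (hpos : ∀ d, 0 < d → ∀ k, 0 < ω d k)
    (hsum : ∀ d, 0 < d → Summable fun k => ((ω d k) ^ 2)⁻¹)
    (crit : Crit) :
    (∀ s > (0:ℝ), ∀ t > (0:ℝ),
      (EXPWTst s t (fun d ε => infoComp (ω d) (allInfo d) crit ε) ↔
        EXPWTst s t (fun d ε => infoComp (ω d) (stdInfo (ω d)) crit ε))) ∧
    (EXPWTst 1 1 (fun d ε => infoComp (ω d) (allInfo d) crit ε) ↔
      EXPWTst 1 1 (fun d ε => infoComp (ω d) (stdInfo (ω d)) crit ε)) := by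
  have key : ∀ s > (0:ℝ), ∀ t > (0:ℝ),
      (EXPWTst s t (fun d ε => infoComp (ω d) (allInfo d) crit ε) ↔
        EXPWTst s t (fun d ε => infoComp (ω d) (stdInfo (ω d)) crit ε)) := by
    intro s hs t ht
    constructor
    · exact wt_of_poly s t hs ht _ _ fun d hd ε hε =>
        infoComp_std_le (ω d) (hpos d hd) (hsum d hd) crit ε hε
    · exact wt_of_le s t _ _ fun d hd ε hε =>
        infoComp_all_le (ω d) (hpos d hd) (hsum d hd) crit ε hε
  exact ⟨key, key 1 one_pos 1 one_pos⟩
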